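/- Let E be a complex Banach space and T a bounded operator on E whose spectrum is contained in the open right half-plane {z : Re z > 0}. Then every closed subspace F of E that is invariant under T² is also invariant under T. -/

import Mathlib

open Polynomial Filter Topology
open scoped ENNReal NNReal

/-- Even and odd parts of `(1+z)^m`, as polynomials in `z²`. -/
noncomputable def evenOddParts : ℕ → ℂ[X] × ℂ[X]
  | 0 => (1, 0)
  | m + 1 => ((evenOddParts m).1 + X * (evenOddParts m).2, (evenOddParts m).1 + (evenOddParts m).2)

theorem evenOddParts_spec (m : ℕ) {B : Type*} [Ring B] [Algebra ℂ B] (a : B) :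
    (1 + a) ^ m = aeval (a ^ 2) (evenOddParts m).1 + a * aeval (a ^ 2) (evenOddParts m).2 ∧
    (1 - a) ^ m = aeval (a ^ 2) (evenOddParts m).1 - a * aeval (a ^ 2) (evenOddParts m).2 := by
  induction m with
  | zero => simp [evenOddParts]
  | succ m ih =>
    obtain ⟨h1, h2⟩ := ih
    rw [pow_succ' (1 + a), pow_succ' (1 - a), h1, h2]
    simp only [evenOddParts, map_add, map_mul, aeval_X]
    constructor <;> noncomm_ring

theorem norm_one_sub_lt (y : ℂ) (h2 : 0 < y.re) : ‖1 - y‖ < ‖1 + y‖ := by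
  have h6 : ‖1 - y‖ ^ 2 < ‖1 + y‖ ^ 2 := by
    rw [← Complex.normSq_eq_norm_sq, ← Complex.normSq_eq_norm_sq, Complex.normSq_apply,
      Complex.normSq_apply]
    simp only [Complex.sub_re, Complex.sub_im, Complex.add_re, Complex.add_im, Complex.one_re,
      Complex.one_im]
    nlinarith
  exact lt_of_pow_lt_pow_left₀ 2 (norm_nonneg _) h6

theorem even_part_ne_zero (m : ℕ) (z : ℂ) (hz : 0 < z.re) :
    eval (z ^ 2) (evenOddParts m).1 ≠ 0 := by
  intro h0
  obtain ⟨h1, h2⟩ := evenOddParts_spec m z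
  simp only [coe_aeval_eq_eval, h0] at h1 h2
  have h3 : (1 + z) ^ m = -(1 - z) ^ m := by rw [h1, h2]; ring
  rcases Nat.eq_zero_or_pos m with rfl | hm
  · norm_num at h3
  · have h4 := congrArg norm h3
    rw [norm_neg, norm_pow, norm_pow] at h4
    have := pow_lt_pow_left₀ (norm_one_sub_lt z hz) (norm_nonneg _) hm.ne'
    linarith

theorem tendsto_pow_zero_of_spectrum {B : Type*} [NormedRing B] [NormedAlgebra ℂ B]
    [CompleteSpace B] [Nontrivial B] (c : B) (hc : ∀ z ∈ spectrum ℂ c, ‖z‖ < 1) :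
    Tendsto (fun n : ℕ => ‖c ^ n‖) atTop (𝓝 0) := by
  have h1 : spectralRadius ℂ c < (1 : ℝ≥0) :=
    spectrum.spectralRadius_lt_of_forall_lt_of_nonempty (spectrum.nonempty c)
      (fun k hk => by simpa [← NNReal.coe_lt_coe] using hc k hk)
  obtain ⟨r, hr1, hr2⟩ := ENNReal.lt_iff_exists_nnreal_btwn.1 h1
  have hr2' : r < 1 := by exact_mod_cast hr2
  have h2 := (spectrum.pow_nnnorm_pow_one_div_tendsto_nhds_spectralRadius c).eventually
    (gt_mem_nhds hr1)
  have h3 : ∀ᶠ n : ℕ in atTop, ‖c ^ n‖ ≤ (r : ℝ) ^ n := by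
    filter_upwards [h2, eventually_gt_atTop 0] with n hn hn0
    have hn0' : (0 : ℝ) < n := by exact_mod_cast hn0
    have := ENNReal.rpow_le_rpow hn.le hn0'.le
    rw [← ENNReal.rpow_mul, one_div_mul_cancel hn0'.ne', ENNReal.rpow_one,
      ENNReal.rpow_natCast] at this
    exact_mod_cast this
  refine squeeze_zero' (Eventually.of_forall fun n => norm_nonneg _) h3 ?_
  exact tendsto_pow_atTop_nhds_zero_of_lt_one r.2 (by exact_mod_cast hr2')

theorem exists_sqrt (w : ℂ) (hw : ¬ ∃ t : ℝ, 0 ≤ t ∧ w = -(t : ℂ)) :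
    ∃ z : ℂ, z ^ 2 = w ∧ 0 < z.re := by
  obtain ⟨z, hz⟩ := IsAlgClosed.exists_pow_nat_eq w (n := 2) (by norm_num)
  rcases lt_trichotomy z.re 0 with h | h | h
  · exact ⟨-z, by simpa using hz, by simpa using h⟩
  · exfalso
    apply hw
    refine ⟨z.im ^ 2, sq_nonneg _, ?_⟩
    rw [← hz]
    apply Complex.ext <;> simp [pow_two, h]
  · exact ⟨z, hz, h⟩

theorem cayley_spectrum {B : Type*} [Ring B] [Algebra ℂ B] (a v : B)
    (ha : ∀ z ∈ spectrum ℂ a, 0 < z.re) (hv : (1 + a) * v = 1) (hv' : v * (1 + a) = 1) :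
    ∀ z ∈ spectrum ℂ ((1 - a) * v), ‖z‖ < 1 := by
  intro z hz
  by_contra hlt
  push Not at hlt
  apply spectrum.mem_iff.1 hz
  have hvu : IsUnit v := ⟨⟨v, 1 + a, hv', hv⟩, rfl⟩
  have key : algebraMap ℂ B z - (1 - a) * v =
      (algebraMap ℂ B (z - 1) + algebraMap ℂ B (z + 1) * a) * v := by
    have : algebraMap ℂ B z = algebraMap ℂ B z * ((1 + a) * v) := by rw [hv, mul_one]
    rw [this]
    simp only [map_add, map_sub, map_one]
    noncomm_ring
  rw [key]
  refine IsUnit.mul ?_ hvu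
  by_cases h1 : z + 1 = 0
  · rw [h1, map_zero, zero_mul, add_zero]
    refine IsUnit.map (algebraMap ℂ B) (isUnit_iff_ne_zero.2 fun h => ?_)
    have : (2 : ℂ) = 0 := by linear_combination h1 - h
    norm_num at this
  · have e : algebraMap ℂ B (z - 1) + algebraMap ℂ B (z + 1) * a =
        algebraMap ℂ B (-(z + 1)) * (algebraMap ℂ B ((1 - z) / (z + 1)) - a) := by
      rw [mul_sub, ← map_mul]
      have : -(z + 1) * ((1 - z) / (z + 1)) = z - 1 := by field_simp; ring
      rw [this, map_neg]; noncomm_ring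
    rw [e]
    refine IsUnit.mul (IsUnit.map (algebraMap ℂ B) (isUnit_iff_ne_zero.2 (neg_ne_zero.2 h1))) ?_
    rw [← spectrum.notMem_iff]
    intro hmem
    have h2 := ha _ hmem
    set y := (1 - z) / (z + 1) with hy
    have h3 : y * (z + 1) = 1 - z := by rw [hy]; field_simp
    have h4 : z * (1 + y) = 1 - y := by linear_combination h3
    have h5 : ‖z‖ * ‖1 + y‖ = ‖1 - y‖ := by rw [← norm_mul, h4]
    have h6 := norm_one_sub_lt y h2
    nlinarith [norm_nonneg (1 + y), norm_nonneg (1 - y)]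

theorem mem_of_sq_mem {B : Type*} [NormedRing B] [NormedAlgebra ℂ B]
    [CompleteSpace B] [Nontrivial B] (a : B) (ha : ∀ z ∈ spectrum ℂ a, 0 < z.re)
    (A : Subalgebra ℂ B) (hA : IsClosed (A : Set B)) (h2 : a ^ 2 ∈ A) : a ∈ A := by
  have := hA
  have : CompleteSpace A := hA.completeSpace_coe
  let s : A := ⟨a ^ 2, h2⟩
  -- the spectrum of `a²` avoids the closed negative axis
  have hneg : ∀ t : ℝ, 0 ≤ t → -(t : ℂ) ∉ spectrum ℂ (a ^ 2) := by
    intro t ht hmem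
    have hm := spectrum.map_polynomial_aeval_of_nonempty a (X ^ 2 : ℂ[X]) (spectrum.nonempty a)
    simp only [map_pow, aeval_X, eval_pow, eval_X] at hm
    rw [hm] at hmem
    obtain ⟨z, hz, hzt⟩ := hmem
    have h0 := ha z hz
    have him := congrArg Complex.im hzt
    have hre := congrArg Complex.re hzt
    simp [pow_two] at him hre
    have : z.im = 0 := by nlinarith
    rw [this] at hre
    nlinarith
  -- so does its spectrum relative to `A`
  have hnegA : ∀ t : ℝ, 0 ≤ t → -(t : ℂ) ∉ spectrum ℂ s := by
    intro t ht hmem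
    have hb := Subalgebra.spectrum_isBounded_connectedComponentIn A s hmem
    let R : Set ℂ := (fun t : ℝ => -(t : ℂ)) '' Set.Ici 0
    have hRc : IsPreconnected R := isPreconnected_Ici.image _ (by fun_prop)
    have hRs : R ⊆ (spectrum ℂ (s : B))ᶜ := by
      rintro _ ⟨t, ht, rfl⟩
      exact hneg t ht
    have hsub := hRc.subset_connectedComponentIn (x := -(t : ℂ)) ⟨t, ht, rfl⟩ hRs
    obtain ⟨M, hM⟩ := (hb.subset hsub).exists_norm_le
    have := hM (-((|M| + 1 : ℝ) : ℂ)) ⟨|M| + 1, by simp; positivity, rfl⟩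
    rw [norm_neg, Complex.norm_real, Real.norm_of_nonneg (by positivity)] at this
    linarith [le_abs_self M]
  -- the Cayley transform
  have hu : IsUnit (1 + a) := by
    have : (-1 : ℂ) ∉ spectrum ℂ a := fun h => by
      have := ha _ h
      norm_num at this
    rw [spectrum.notMem_iff] at this
    have h := this.neg
    simpa [add_comm] using h
  obtain ⟨u, hu⟩ := hu
  let v : B := ↑u⁻¹
  have hv : (1 + a) * v = 1 := by rw [← hu]; exact u.mul_inv
  have hv' : v * (1 + a) = 1 := by rw [← hu]; exact u.inv_mul
  let c := (1 - a) * v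
  have hc0 : Tendsto (fun n : ℕ => ‖c ^ n‖) atTop (𝓝 0) :=
    tendsto_pow_zero_of_spectrum c (cayley_spectrum a v ha hv hv')
  have hcu : c * (1 + a) = 1 - a := by simp only [c]; rw [mul_assoc, hv', mul_one]
  have hcomm : Commute c (1 + a) := by
    have h1 : (1 + a) * (1 - a) = (1 - a) * (1 + a) := by noncomm_ring
    change c * (1 + a) = (1 + a) * c
    rw [hcu]; simp only [c]; rw [← mul_assoc, h1, mul_assoc, hv, mul_one]
  -- the approximants
  have key : ∀ m : ℕ, ∃ b ∈ A, ∃ d : B, d + c ^ m * d = 2 ∧ a - b = a * (c ^ m * d) := by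
    intro m
    obtain ⟨h1, h2'⟩ := evenOddParts_spec m a
    have hne := even_part_ne_zero m
    generalize (evenOddParts m).1 = p at h1 h2' hne
    generalize (evenOddParts m).2 = q at h1 h2'
    have hunit : IsUnit (aeval s p) := by
      rw [← spectrum.zero_notMem_iff ℂ,
        spectrum.map_polynomial_aeval_of_nonempty s p (spectrum.nonempty s)]
      rintro ⟨w, hw, hw0⟩
      obtain ⟨z, rfl, hz⟩ := exists_sqrt w (by
        rintro ⟨t, ht, rfl⟩
        exact hnegA t ht hw)
      exact hne z hz hw0
    obtain ⟨W, hW⟩ := hunit.exists_right_inv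
    have hp : A.val (aeval s p) = aeval (a ^ 2) p := (aeval_algHom_apply A.val s p).symm
    have hq : A.val (aeval s q) = aeval (a ^ 2) q := (aeval_algHom_apply A.val s q).symm
    have hPW : aeval (a ^ 2) p * A.val W = 1 := by
      rw [← hp, ← map_mul, hW, map_one]
    refine ⟨A.val (s * aeval s q * W), (s * aeval s q * W).2, (1 + a) ^ m * A.val W,
      ?_, ?_⟩
    · rw [← mul_assoc, ← hcomm.mul_pow, hcu, h1, h2', ← add_mul]
      have : aeval (a ^ 2) p + a * aeval (a ^ 2) q + (aeval (a ^ 2) p - a * aeval (a ^ 2) q) =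
        2 * aeval (a ^ 2) p := by noncomm_ring
      rw [this, mul_assoc, hPW, mul_one]
    · rw [← mul_assoc (c ^ m), ← hcomm.mul_pow, hcu, h2', sub_mul, hPW]
      have hs : A.val s = a ^ 2 := rfl
      rw [map_mul, map_mul, hq, hs]
      noncomm_ring
  choose b hb d hd hbd using key
  have hlim : Tendsto b atTop (𝓝 a) := by
    rw [tendsto_iff_norm_sub_tendsto_zero]
    have hg : Tendsto (fun m : ℕ => ‖a‖ * (‖c ^ m‖ * (2 * ‖(2 : B)‖))) atTop (𝓝 0) := by
      simpa using (hc0.mul_const (2 * ‖(2 : B)‖)).const_mul ‖a‖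
    refine squeeze_zero' (Eventually.of_forall fun n => norm_nonneg _) ?_ hg
    filter_upwards [hc0.eventually (gt_mem_nhds (show (0 : ℝ) < 1 / 2 by norm_num))] with m hm
    rw [norm_sub_rev, hbd]
    have h1 : ‖d m‖ ≤ ‖(2 : B)‖ + ‖c ^ m‖ * ‖d m‖ := by
      calc ‖d m‖ = ‖2 - c ^ m * d m‖ := by rw [← hd m]; simp
        _ ≤ ‖(2 : B)‖ + ‖c ^ m * d m‖ := norm_sub_le _ _
        _ ≤ _ := by gcongr; exact norm_mul_le _ _
    have h3 : ‖d m‖ ≤ 2 * ‖(2 : B)‖ := by nlinarith [norm_nonneg (d m)]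
    calc ‖a * (c ^ m * d m)‖ ≤ ‖a‖ * ‖c ^ m * d m‖ := norm_mul_le _ _
      _ ≤ ‖a‖ * (‖c ^ m‖ * ‖d m‖) := by gcongr; exact norm_mul_le _ _
      _ ≤ _ := by gcongr
  exact hA.mem_of_tendsto hlim (Eventually.of_forall hb)

/-- If `T` is a bounded operator on a complex Banach space whose spectrum lies in
the open right half-plane, then every closed subspace invariant under `T²` is
invariant under `T`. -/
theorem invariant_of_sq_invariant
    {E : Type*} [NormedAddCommGroup E] [NormedSpace ℂ E] [CompleteSpace E]
    (T : E →L[ℂ] E) (hspec : ∀ z ∈ spectrum ℂ T, 0 < z.re)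
    (F : Submodule ℂ E) (hclosed : IsClosed (F : Set E))
    (hT2 : ∀ x ∈ F, T (T x) ∈ F) :
    ∀ x ∈ F, T x ∈ F := by
  rcases subsingleton_or_nontrivial E with hE | hE
  · intro x hx
    rwa [Subsingleton.elim (T x) x]
  let A : Subalgebra ℂ (E →L[ℂ] E) :=
    { carrier := {X | ∀ x ∈ F, X x ∈ F}
      mul_mem' := fun {X Y} hX hY x hx => hX _ (hY x hx)
      add_mem' := fun {X Y} hX hY x hx => F.add_mem (hX x hx) (hY x hx)
      algebraMap_mem' := fun r x hx => F.smul_mem r hx }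
  have hA : IsClosed (A : Set (E →L[ℂ] E)) := by
    have : (A : Set (E →L[ℂ] E)) = ⋂ x ∈ F, (fun X : E →L[ℂ] E => X x) ⁻¹' (F : Set E) := by
      ext X
      simp only [Set.mem_iInter]
      rfl
    rw [this]
    exact isClosed_biInter fun x _ => hclosed.preimage (by fun_prop)
  exact mem_of_sq_mem T hspec A hA (fun x hx => by simpa [pow_two] using hT2 x hx)
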